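/- Let ψ(x) = exp(−‖x‖²), and for R ≥ 1, j ∈ {1,…,d} let g_{R,j}(x) = x_j ψ(x/R). Let α ∈ (1,2), let μ_α be the rotationally invariant α-stable probability measure on ℝ^d with characteristic function exp(−‖ξ‖^α/2), and ν_α(du) = c_{α,d}‖u‖^{−d−α}du its Lévy measure. Let X be a centered random vector in ℝ^d with E‖X‖ < ∞ and law μ such that, for every j ∈ {1,…,d}, lim_{R→∞} ( Var(g_{R,j}(X)) − E[∫ |g_{R,j}(X+u) − g_{R,j}(X)|² ν_α(du)] ) = 0. If U_α(μ) = 1, then μ = μ_α. -/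

import Mathlib

open MeasureTheory ProbabilityTheory Filter Set
open scoped RealInnerProductSpace ENNReal NNReal Topology

noncomputable section

/-- The normalizing constant `c_{α,d}` of the rotationally invariant `α`-stable law. -/
def stableCst (d : ℕ) (α : ℝ) : ℝ :=
  -α * (α - 1) * Real.Gamma ((α + d) / 2) /
    (4 * Real.cos (α * Real.pi / 2) * Real.Gamma ((α + 1) / 2) *
      Real.pi ^ (((d : ℝ) - 1) / 2) * Real.Gamma (2 - α))

/-- The Lévy measure `ν_α(du) = c_{α,d} ‖u‖^{−d−α} du`. -/
def stableLevy (d : ℕ) (α : ℝ) : Measure (EuclideanSpace ℝ (Fin d)) :=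
  volume.withDensity fun u => ENNReal.ofReal (stableCst d α / ‖u‖ ^ ((d : ℝ) + α))

/-- The characteristic function of a measure on `ℝ^d`. -/
def charFn {d : ℕ} (μ : Measure (EuclideanSpace ℝ (Fin d)))
    (ξ : EuclideanSpace ℝ (Fin d)) : ℂ :=
  ∫ x, Complex.exp (Complex.I * (⟪ξ, x⟫ : ℂ)) ∂μ

/-- The Dirichlet-type energy `E[∫ |f(X+u) − f(X)|² ν_α(du)]`. -/
def Dform {d : ℕ} (να μ : Measure (EuclideanSpace ℝ (Fin d)))
    (f : EuclideanSpace ℝ (Fin d) → ℝ) : ℝ≥0∞ :=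
  ∫⁻ x, (∫⁻ u, ENNReal.ofReal ((f (x + u) - f x) ^ 2) ∂να) ∂μ

/-- The Poincaré-ratio functional `U_α`. -/
def Ufun {d : ℕ} (να μ : Measure (EuclideanSpace ℝ (Fin d))) : ℝ :=
  sSup {v : ℝ | ∃ f : EuclideanSpace ℝ (Fin d) → ℝ, Measurable f ∧
    evariance f μ < ⊤ ∧ 0 < Dform να μ f ∧ Dform να μ f < ⊤ ∧
    v = (evariance f μ).toReal / (Dform να μ f).toReal}

/-- The truncated coordinate functions `g_{R,j}(x) = x_j exp(−‖x/R‖²)`. -/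
def gTrunc {d : ℕ} (R : ℝ) (j : Fin d) (x : EuclideanSpace ℝ (Fin d)) : ℝ :=
  x j * Real.exp (-‖R⁻¹ • x‖ ^ 2)

/-! ### Exponential integrals -/

lemma lintegral_rpow_mul_exp_neg_mul {p r : ℝ} (hp : 0 < p) (hr : 0 < r) :
    ∫⁻ s in Ioi (0 : ℝ), ENNReal.ofReal (s ^ (p - 1) * Real.exp (-(r * s))) =
      ENNReal.ofReal ((1 / r) ^ p * Real.Gamma p) := by
  have h := Real.integral_rpow_mul_exp_neg_mul_Ioi hp hr
  have hpos : 0 < (1 / r) ^ p * Real.Gamma p :=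
    mul_pos (Real.rpow_pos_of_pos (by positivity) _) (Real.Gamma_pos_of_pos hp)
  rw [← h, ofReal_integral_eq_lintegral_ofReal]
  · by_contra hni
    rw [integral_undef hni] at h
    exact hpos.ne h
  · filter_upwards [ae_restrict_mem measurableSet_Ioi] with s hs
    have : (0 : ℝ) < s := hs
    simp only [Pi.zero_apply]
    positivity

lemma lintegral_rpow_mul_exp_neg_div {β y : ℝ} (hβ : β < 1) (hy : 0 < y) :
    ∫⁻ s in Ioi (0 : ℝ), ENNReal.ofReal (s ^ (β - 2) * Real.exp (-(y / s))) =
      ENNReal.ofReal (Real.Gamma (1 - β) * y ^ (β - 1)) := by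
  have h := Real.integral_rpow_mul_exp_neg_mul_Ioi (a := 1 - β) (by linarith) hy
  rw [← integral_comp_rpow_Ioi _ (p := -1) (by norm_num)] at h
  have h' : ∫ s in Ioi (0 : ℝ), s ^ (β - 2) * Real.exp (-(y / s)) =
      Real.Gamma (1 - β) * y ^ (β - 1) := by
    have e : Real.Gamma (1 - β) * y ^ (β - 1) = (1 / y) ^ (1 - β) * Real.Gamma (1 - β) := by
      rw [one_div, Real.inv_rpow hy.le, ← Real.rpow_neg hy.le, mul_comm]
      congr 2; ring
    rw [e, ← h]
    refine setIntegral_congr_fun measurableSet_Ioi fun s hs => ?_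
    have hs : (0 : ℝ) < s := hs
    simp only [abs_neg, abs_one, one_mul, smul_eq_mul, Real.rpow_neg_one]
    rw [Real.inv_rpow hs.le, ← Real.rpow_neg hs.le, ← mul_assoc, ← Real.rpow_add hs,
      div_eq_mul_inv]
    congr 2; ring
  have hpos : 0 < Real.Gamma (1 - β) * y ^ (β - 1) :=
    mul_pos (Real.Gamma_pos_of_pos (by linarith)) (Real.rpow_pos_of_pos hy _)
  rw [← h', ofReal_integral_eq_lintegral_ofReal]
  · by_contra hni
    rw [integral_undef hni] at h'
    exact hpos.ne h'
  · filter_upwards [ae_restrict_mem measurableSet_Ioi] with s hs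
    have : (0 : ℝ) < s := hs
    simp only [Pi.zero_apply]
    positivity

lemma lintegral_rpow_mul_one_sub_exp {β a : ℝ} (h0 : 0 < β) (h1 : β < 1) (ha : 0 ≤ a) :
    ∫⁻ s in Ioi (0 : ℝ), ENNReal.ofReal (s ^ (β - 1) * (1 - Real.exp (-(a / s)))) =
      ENNReal.ofReal (Real.Gamma (1 - β) * a ^ β / β) := by
  have key : ∀ s ∈ Ioi (0 : ℝ), ENNReal.ofReal (s ^ (β - 1) * (1 - Real.exp (-(a / s)))) =
      ∫⁻ y in Ioc 0 a, ENNReal.ofReal (s ^ (β - 2) * Real.exp (-(y / s))) := by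
    intro s hs
    have hs : (0 : ℝ) < s := hs
    have hc : Continuous fun y : ℝ => s ^ (β - 2) * Real.exp (-(y / s)) := by fun_prop
    have hI := intervalIntegral.integral_eq_sub_of_hasDerivAt (a := 0) (b := a)
      (f := fun y => -(s ^ (β - 1) * Real.exp (-(y / s))))
      (f' := fun y => s ^ (β - 2) * Real.exp (-(y / s))) (fun y _ => by
        have := ((((hasDerivAt_id y).div_const s).neg.exp).const_mul (s ^ (β - 1))).neg
        have e : s ^ (β - 1) = s ^ (β - 2) * s := by
          rw [← Real.rpow_add_one hs.ne']; congr 1; ring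
        refine this.congr_deriv ?_
        rw [e]
        simp only [Pi.neg_apply, id]
        field_simp) (hc.intervalIntegrable _ _)
    rw [← ofReal_integral_eq_lintegral_ofReal, ← intervalIntegral.integral_of_le ha, hI]
    · congr 1; simp; ring
    · exact (hc.integrableOn_Icc).mono_set Ioc_subset_Icc_self
    · exact Eventually.of_forall fun y => by
        simp only [Pi.zero_apply]; positivity
  rw [setLIntegral_congr_fun measurableSet_Ioi key, lintegral_lintegral_swap]
  · have e : ∀ y ∈ Ioc 0 a,
        ∫⁻ s in Ioi (0 : ℝ), ENNReal.ofReal (s ^ (β - 2) * Real.exp (-(y / s))) =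
          ENNReal.ofReal (Real.Gamma (1 - β) * y ^ (β - 1)) := fun y hy =>
      lintegral_rpow_mul_exp_neg_div h1 hy.1
    rw [setLIntegral_congr_fun measurableSet_Ioc e, ← ofReal_integral_eq_lintegral_ofReal,
      ← intervalIntegral.integral_of_le ha, intervalIntegral.integral_const_mul,
      integral_rpow (Or.inl (by linarith))]
    · congr 1
      rw [sub_add_cancel, Real.zero_rpow h0.ne']; ring
    · have := (intervalIntegral.intervalIntegrable_rpow' (a := 0) (b := a) (r := β - 1)
        (by linarith)).const_mul (Real.Gamma (1 - β))
      exact (intervalIntegrable_iff_integrableOn_Ioc_of_le ha).1 this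
    · filter_upwards [ae_restrict_mem measurableSet_Ioc] with y hy
      exact mul_nonneg (Real.Gamma_pos_of_pos (by linarith)).le (Real.rpow_nonneg hy.1.le _)
  · fun_prop

lemma lintegral_one_sub_cos_mul_exp {d : ℕ} (ξ : EuclideanSpace ℝ (Fin d)) {s : ℝ} (hs : 0 < s) :
    ∫⁻ u : EuclideanSpace ℝ (Fin d),
        ENNReal.ofReal ((1 - Real.cos ⟪ξ, u⟫) * Real.exp (-(s * ‖u‖ ^ 2))) =
      ENNReal.ofReal ((Real.pi / s) ^ ((d : ℝ) / 2) * (1 - Real.exp (-(‖ξ‖ ^ 2 / 4 / s)))) := by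
  have hsc : 0 < (s : ℂ).re := by simpa using hs
  have g := fun c : ℂ => GaussianFourier.integral_cexp_neg_mul_sq_norm_add hsc c ξ
  have gi := fun c : ℂ => GaussianFourier.integrable_cexp_neg_mul_sq_norm_add hsc c ξ
  have hre : ∀ u : EuclideanSpace ℝ (Fin d),
      (1 - Real.cos ⟪ξ, u⟫) * Real.exp (-(s * ‖u‖ ^ 2)) =
      (Complex.exp (-(s : ℂ) * (‖u‖ : ℂ) ^ 2 + 0 * ((⟪ξ, u⟫ : ℝ) : ℂ)) -
        Complex.exp (-(s : ℂ) * (‖u‖ : ℂ) ^ 2 + Complex.I * ((⟪ξ, u⟫ : ℝ) : ℂ))).re := by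
    intro u
    rw [Complex.sub_re, Complex.exp_re, Complex.exp_re]
    have h1 : (-(s : ℂ) * (‖u‖ : ℂ) ^ 2) = ((-(s * ‖u‖ ^ 2) : ℝ) : ℂ) := by push_cast; ring
    rw [h1]
    generalize -(s * ‖u‖ ^ 2) = r
    simp
    ring
  have hint := (gi 0).sub (gi Complex.I)
  rw [← ofReal_integral_eq_lintegral_ofReal]
  · congr 1
    simp_rw [hre]
    have := integral_re hint
    simp only [Pi.sub_apply, RCLike.re_eq_complex_re] at this
    rw [this, integral_sub (gi 0) (gi Complex.I), g, g, finrank_euclideanSpace_fin]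
    have e1 : ((Real.pi : ℂ) / s) ^ ((d : ℂ) / 2) = (((Real.pi / s) ^ ((d : ℝ) / 2) : ℝ) : ℂ) := by
      rw [Complex.ofReal_cpow (by positivity)]; push_cast; rfl
    have e2 : Complex.I ^ 2 * (‖ξ‖ : ℂ) ^ 2 / (4 * s) = ((-(‖ξ‖ ^ 2 / 4 / s) : ℝ) : ℂ) := by
      rw [Complex.I_sq]; push_cast; field_simp
    rw [e1, e2, ← Complex.ofReal_exp]
    simp only [ne_eq, OfNat.ofNat_ne_zero, not_false_eq_true, zero_pow, zero_mul, zero_div,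
      Complex.exp_zero, mul_one]
    rw [← Complex.ofReal_mul, ← Complex.ofReal_sub, Complex.ofReal_re]
    ring
  · simp_rw [hre]
    exact hint.re
  · exact Eventually.of_forall fun u =>
      mul_nonneg (sub_nonneg.2 (Real.cos_le_one _)) (Real.exp_pos _).le

/-! ### The Lévy measure -/

lemma stableCst_pos (d : ℕ) {α : ℝ} (hα : α ∈ Ioo (1 : ℝ) 2) : 0 < stableCst d α := by
  obtain ⟨h1, h2⟩ := hα
  have hc : Real.cos (α * Real.pi / 2) < 0 :=
    Real.cos_neg_of_pi_div_two_lt_of_lt (by nlinarith [Real.pi_pos]) (by nlinarith [Real.pi_pos])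
  have g1 : 0 < Real.Gamma ((α + d) / 2) := Real.Gamma_pos_of_pos (by positivity)
  have g2 : 0 < Real.Gamma ((α + 1) / 2) := Real.Gamma_pos_of_pos (by positivity)
  have g3 : 0 < Real.Gamma (2 - α) := Real.Gamma_pos_of_pos (by linarith)
  have g4 : 0 < Real.pi ^ (((d : ℝ) - 1) / 2) := Real.rpow_pos_of_pos Real.pi_pos _
  unfold stableCst
  apply div_pos_of_neg_of_neg
  · have : 0 < α * (α - 1) * Real.Gamma ((α + d) / 2) := by
      have : 0 < α - 1 := by linarith
      positivity
    linarith
  · have : 0 < -Real.cos (α * Real.pi / 2) * (4 * Real.Gamma ((α + 1) / 2) *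
      Real.pi ^ (((d : ℝ) - 1) / 2) * Real.Gamma (2 - α)) := by
      have : 0 < -Real.cos (α * Real.pi / 2) := by linarith
      positivity
    linarith

lemma gamma_identity {α : ℝ} (hα : α ∈ Ioo (1 : ℝ) 2) :
    (1 - α) * √Real.pi * 2 ^ (-α) * Real.Gamma (1 - α / 2) =
      Real.cos (α * Real.pi / 2) * Real.Gamma ((α + 1) / 2) * Real.Gamma (2 - α) := by
  obtain ⟨h1, h2⟩ := hα
  have hc : Real.cos (α * Real.pi / 2) < 0 :=
    Real.cos_neg_of_pi_div_two_lt_of_lt (by nlinarith [Real.pi_pos]) (by nlinarith [Real.pi_pos])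
  have hd := Real.Gamma_mul_Gamma_add_half ((1 - α) / 2)
  have hr := Real.Gamma_mul_Gamma_one_sub ((α + 1) / 2)
  have hs : Real.sin (Real.pi * ((α + 1) / 2)) = Real.cos (α * Real.pi / 2) := by
    rw [← Real.sin_add_pi_div_two]; congr 1; ring
  have hG : Real.Gamma (2 - α) = (1 - α) * Real.Gamma (1 - α) := by
    rw [← Real.Gamma_add_one (by linarith)]; congr 1; ring
  rw [hs, show 1 - (α + 1) / 2 = (1 - α) / 2 by ring, eq_div_iff hc.ne] at hr
  rw [show (1 - α) / 2 + 1 / 2 = 1 - α / 2 by ring, show 2 * ((1 - α) / 2) = 1 - α by ring,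
    show 1 - (1 - α) = α by ring] at hd
  have h2 : (2 : ℝ) ^ (-α) * 2 ^ α = 1 := by rw [← Real.rpow_add (by norm_num)]; simp
  have hpi : √Real.pi * √Real.pi = Real.pi := Real.mul_self_sqrt Real.pi_pos.le
  have hpp : √Real.pi ≠ 0 := (Real.sqrt_pos.2 Real.pi_pos).ne'
  rw [hG]
  apply mul_left_cancel₀ hpp
  linear_combination ((1 - α) * 2 ^ (-α) * Real.Gamma (1 - α / 2)) * (hpi - hr)
    + (1 - α) * 2 ^ (-α) * Real.cos (α * Real.pi / 2) * Real.Gamma ((α + 1) / 2) * hd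
    + ((1 - α) * Real.cos (α * Real.pi / 2) * Real.Gamma ((α + 1) / 2) * Real.Gamma (1 - α)
      * √Real.pi) * h2

lemma lintegral_one_sub_cos_stableLevy {d : ℕ} (hd : 0 < d) {α : ℝ} (hα : α ∈ Ioo (1 : ℝ) 2)
    (ξ : EuclideanSpace ℝ (Fin d)) :
    ∫⁻ u, ENNReal.ofReal (1 - Real.cos ⟪ξ, u⟫) ∂(stableLevy d α) =
      ENNReal.ofReal (‖ξ‖ ^ α / 2) := by
  have hc := stableCst_pos d hα
  have hid := gamma_identity hα
  obtain ⟨h1, h2⟩ := hα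
  have : NeZero d := ⟨hd.ne'⟩
  set p : ℝ := (α + d) / 2 with hp
  have hp0 : 0 < p := by positivity
  have hΓ := Real.Gamma_pos_of_pos hp0
  have hcos : ∀ u : EuclideanSpace ℝ (Fin d), 0 ≤ 1 - Real.cos ⟪ξ, u⟫ := fun u =>
    sub_nonneg.2 (Real.cos_le_one _)
  unfold stableLevy
  rw [lintegral_withDensity_eq_lintegral_mul _ (by fun_prop) (by fun_prop)]
  simp only [Pi.mul_apply]
  have step : ∀ᵐ u : EuclideanSpace ℝ (Fin d),
      ENNReal.ofReal (stableCst d α / ‖u‖ ^ ((d : ℝ) + α)) *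
        ENNReal.ofReal (1 - Real.cos ⟪ξ, u⟫) =
      ∫⁻ s in Ioi (0 : ℝ), ENNReal.ofReal (stableCst d α / Real.Gamma p * s ^ (p - 1)) *
        ENNReal.ofReal ((1 - Real.cos ⟪ξ, u⟫) * Real.exp (-(s * ‖u‖ ^ 2))) := by
    have : ∀ᵐ u : EuclideanSpace ℝ (Fin d), u ≠ 0 := by
      simp [ae_iff]
    filter_upwards [this] with u hu
    have hu' : 0 < ‖u‖ := norm_pos_iff.2 hu
    have e : ∀ s ∈ Ioi (0 : ℝ), ENNReal.ofReal (stableCst d α / Real.Gamma p * s ^ (p - 1)) *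
        ENNReal.ofReal ((1 - Real.cos ⟪ξ, u⟫) * Real.exp (-(s * ‖u‖ ^ 2))) =
        ENNReal.ofReal (stableCst d α / Real.Gamma p * (1 - Real.cos ⟪ξ, u⟫)) *
          ENNReal.ofReal (s ^ (p - 1) * Real.exp (-(‖u‖ ^ 2 * s))) := by
      intro s hs
      have hs : (0 : ℝ) < s := hs
      rw [← ENNReal.ofReal_mul (by positivity),
        ← ENNReal.ofReal_mul (mul_nonneg (by positivity) (hcos u))]
      congr 1
      rw [mul_comm s]; ring
    rw [setLIntegral_congr_fun measurableSet_Ioi e, lintegral_const_mul' _ _ ENNReal.ofReal_ne_top,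
      lintegral_rpow_mul_exp_neg_mul hp0 (by positivity),
      ← ENNReal.ofReal_mul (by positivity),
      ← ENNReal.ofReal_mul (mul_nonneg (by positivity) (hcos u))]
    congr 1
    have : ((1 : ℝ) / ‖u‖ ^ 2) ^ p = 1 / ‖u‖ ^ ((d : ℝ) + α) := by
      rw [Real.div_rpow (by norm_num) (by positivity), Real.one_rpow, ← Real.rpow_natCast,
        ← Real.rpow_mul hu'.le]
      congr 2; rw [hp]; push_cast; ring
    rw [this]
    field_simp
  rw [lintegral_congr_ae step, lintegral_lintegral_swap (by fun_prop)]
  have inner : ∀ s ∈ Ioi (0 : ℝ),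
      ∫⁻ u : EuclideanSpace ℝ (Fin d),
        ENNReal.ofReal (stableCst d α / Real.Gamma p * s ^ (p - 1)) *
        ENNReal.ofReal ((1 - Real.cos ⟪ξ, u⟫) * Real.exp (-(s * ‖u‖ ^ 2))) =
      ENNReal.ofReal (stableCst d α / Real.Gamma p * Real.pi ^ ((d : ℝ) / 2)) *
        ENNReal.ofReal (s ^ (α / 2 - 1) * (1 - Real.exp (-(‖ξ‖ ^ 2 / 4 / s)))) := by
    intro s hs
    have hs : (0 : ℝ) < s := hs
    rw [lintegral_const_mul' _ _ ENNReal.ofReal_ne_top, lintegral_one_sub_cos_mul_exp ξ hs,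
      ← ENNReal.ofReal_mul (by positivity), ← ENNReal.ofReal_mul (by positivity)]
    congr 1
    have : s ^ (α / 2 - 1) = s ^ (p - 1) / s ^ ((d : ℝ) / 2) := by
      rw [← Real.rpow_sub hs]; congr 1; rw [hp]; ring
    rw [Real.div_rpow Real.pi_pos.le hs.le, this]
    ring
  rw [setLIntegral_congr_fun measurableSet_Ioi inner,
    lintegral_const_mul' _ _ ENNReal.ofReal_ne_top,
    lintegral_rpow_mul_one_sub_exp (by linarith) (by linarith) (by positivity),
    ← ENNReal.ofReal_mul (by positivity)]
  congr 1
  have hn : (‖ξ‖ ^ 2 / 4) ^ (α / 2) = ‖ξ‖ ^ α * 2 ^ (-α) := by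
    rw [show ‖ξ‖ ^ 2 / 4 = (‖ξ‖ / 2) ^ (2 : ℝ) by norm_num; ring, ← Real.rpow_mul (by positivity),
      Real.div_rpow (norm_nonneg _) (by norm_num), Real.rpow_neg (by norm_num)]
    rw [show 2 * (α / 2) = α by ring]; rfl
  have hpi : Real.pi ^ ((d : ℝ) / 2) = Real.pi ^ (((d : ℝ) - 1) / 2) * √Real.pi := by
    rw [Real.sqrt_eq_rpow, ← Real.rpow_add Real.pi_pos]; congr 1; ring
  have hcn : Real.cos (α * Real.pi / 2) ≠ 0 :=
    (Real.cos_neg_of_pi_div_two_lt_of_lt (by nlinarith [Real.pi_pos])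
      (by nlinarith [Real.pi_pos])).ne
  have g2 := (Real.Gamma_pos_of_pos (s := (α + 1) / 2) (by positivity)).ne'
  have g3 := (Real.Gamma_pos_of_pos (s := 2 - α) (by linarith)).ne'
  have g4 := (Real.rpow_pos_of_pos Real.pi_pos (((d : ℝ) - 1) / 2)).ne'
  have hα0 : α ≠ 0 := by linarith
  have hΓ' := hΓ.ne'
  rw [show 1 - α / 2 = (2 - α) / 2 by ring] at hid ⊢
  rw [hn, hpi, stableCst, ← hp]
  field_simp
  linear_combination 4 * ‖ξ‖ ^ α * hid

instance {d : ℕ} {α : ℝ} : SigmaFinite (stableLevy d α) := by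
  unfold stableLevy
  exact SigmaFinite.withDensity_ofReal _

lemma volume_absolutelyContinuous_stableLevy {d : ℕ} (hd : 0 < d) {α : ℝ}
    (hα : α ∈ Ioo (1 : ℝ) 2) :
    (volume : Measure (EuclideanSpace ℝ (Fin d))) ≪ stableLevy d α := by
  have hc := stableCst_pos d hα
  have : NeZero d := ⟨hd.ne'⟩
  refine withDensity_absolutelyContinuous' (by fun_prop) ?_
  have : ∀ᵐ u : EuclideanSpace ℝ (Fin d), u ≠ 0 := by
    simp [ae_iff]
  filter_upwards [this] with u hu
  have hu' : 0 < ‖u‖ := norm_pos_iff.2 hu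
  exact (ENNReal.ofReal_pos.2 (by positivity)).ne'

lemma integrable_min_norm_stableLevy {d : ℕ} (hd : 0 < d) {α : ℝ} (hα : α ∈ Ioo (1 : ℝ) 2) :
    Integrable (fun u : EuclideanSpace ℝ (Fin d) => min ‖u‖ (‖u‖ ^ 2)) (stableLevy d α) := by
  have hc := stableCst_pos d hα
  obtain ⟨h1, h2⟩ := hα
  have : NeZero d := ⟨hd.ne'⟩
  unfold stableLevy
  rw [integrable_withDensity_iff (by fun_prop) (by simp)]
  have e : ∀ u : EuclideanSpace ℝ (Fin d),
      min ‖u‖ (‖u‖ ^ 2) * (ENNReal.ofReal (stableCst d α / ‖u‖ ^ ((d : ℝ) + α))).toReal =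
      (fun r : ℝ => min r (r ^ 2) * (stableCst d α / r ^ ((d : ℝ) + α))) ‖u‖ := fun u => by
    rw [ENNReal.toReal_ofReal (by positivity)]
  simp_rw [e]
  refine (integrable_fun_norm_addHaar volume
    (f := fun r : ℝ => min r (r ^ 2) * (stableCst d α / r ^ ((d : ℝ) + α)))).2 ?_
  rw [finrank_euclideanSpace_fin]
  have hdr : ∀ r : ℝ, 0 < r → r ^ (d - 1) * r = r ^ (d : ℝ) := fun r hr => by
    rw [← pow_succ, Real.rpow_natCast, Nat.sub_add_cancel hd]
  rw [← Ioc_union_Ioi_eq_Ioi (zero_le_one' ℝ), integrableOn_union]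
  constructor
  · have hi : IntegrableOn (fun r : ℝ => stableCst d α * r ^ (1 - α)) (Ioc 0 1) :=
      (intervalIntegrable_iff_integrableOn_Ioc_of_le zero_le_one).1
        ((intervalIntegral.intervalIntegrable_rpow' (by linarith)).const_mul _)
    refine hi.congr_fun (fun r hr => ?_) measurableSet_Ioc
    have hr0 := hr.1
    have : r ^ (1 - α) = r ^ (d : ℝ) * r / r ^ ((d : ℝ) + α) := by
      rw [← Real.rpow_add_one hr0.ne', ← Real.rpow_sub hr0]; congr 1; ring
    simp only [smul_eq_mul]
    rw [min_eq_right (by nlinarith [hr.2]), this, ← hdr r hr0]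
    ring
  · have hi : IntegrableOn (fun r : ℝ => stableCst d α * r ^ (-α)) (Ioi 1) :=
      (integrableOn_Ioi_rpow_of_lt (by linarith) one_pos).const_mul _
    refine hi.congr_fun (fun r hr => ?_) measurableSet_Ioi
    have hr1 : (1 : ℝ) < r := hr
    have hr0 : 0 < r := by linarith
    have : r ^ (-α) = r ^ (d : ℝ) / r ^ ((d : ℝ) + α) := by
      rw [← Real.rpow_sub hr0]; congr 1; ring
    simp only [smul_eq_mul]
    rw [min_eq_left (by nlinarith), this, ← hdr r hr0]
    ring

/-! ### Bounded Lipschitz functions and the Poincaré inequality -/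

/-- Bounded Lipschitz functions. -/
def IsBoundedLipschitz {E : Type*} [SeminormedAddCommGroup E] (f : E → ℝ) : Prop :=
  ∃ C : ℝ, 0 ≤ C ∧ (∀ x, |f x| ≤ C) ∧ ∀ x y, |f x - f y| ≤ C * ‖x - y‖

namespace IsBoundedLipschitz

section Normed

variable {E : Type*} [SeminormedAddCommGroup E] {f g : E → ℝ}

lemma continuous (hf : IsBoundedLipschitz f) : Continuous f := by
  obtain ⟨C, h0, -, h2⟩ := hf
  refine (LipschitzWith.of_dist_le_mul (K := ⟨C, h0⟩) fun x y => ?_).continuous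
  rw [Real.dist_eq, dist_eq_norm]
  exact h2 x y

lemma add (hf : IsBoundedLipschitz f) (hg : IsBoundedLipschitz g) :
    IsBoundedLipschitz (f + g) := by
  obtain ⟨C, h0, h1, h2⟩ := hf
  obtain ⟨C', h0', h1', h2'⟩ := hg
  refine ⟨C + C', by positivity, fun x => ?_, fun x y => ?_⟩
  · exact (abs_add_le _ _).trans (add_le_add (h1 x) (h1' x))
  · rw [Pi.add_apply, Pi.add_apply, add_sub_add_comm, add_mul]
    exact (abs_add_le _ _).trans (add_le_add (h2 x y) (h2' x y))

lemma const_smul (hf : IsBoundedLipschitz f) (t : ℝ) : IsBoundedLipschitz (t • f) := by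
  obtain ⟨C, h0, h1, h2⟩ := hf
  refine ⟨|t| * C, by positivity, fun x => ?_, fun x y => ?_⟩
  · rw [Pi.smul_apply, smul_eq_mul, abs_mul]
    exact mul_le_mul_of_nonneg_left (h1 x) (abs_nonneg t)
  · rw [Pi.smul_apply, Pi.smul_apply, smul_eq_mul, smul_eq_mul, ← mul_sub, abs_mul, mul_assoc]
    exact mul_le_mul_of_nonneg_left (h2 x y) (abs_nonneg t)

lemma exists_abs_increment_le (hf : IsBoundedLipschitz f) :
    ∃ C : ℝ, 0 ≤ C ∧ ∀ x u, |f (x + u) - f x| ≤ C * min ‖u‖ 1 := by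
  obtain ⟨C, h0, h1, h2⟩ := hf
  refine ⟨2 * C, by positivity, fun x u => ?_⟩
  rcases min_cases ‖u‖ 1 with ⟨h, -⟩ | ⟨h, -⟩ <;> rw [h]
  · have := h2 (x + u) x
    rw [add_sub_cancel_left] at this
    nlinarith [norm_nonneg u]
  · have := abs_sub (f (x + u)) (f x)
    linarith [h1 (x + u), h1 x]

end Normed

variable {d : ℕ} {α : ℝ} {f g : EuclideanSpace ℝ (Fin d) → ℝ}
  {μ : Measure (EuclideanSpace ℝ (Fin d))}

lemma memLp [IsFiniteMeasure μ] (hf : IsBoundedLipschitz f) : MemLp f 2 μ := by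
  obtain ⟨C, -, h1, -⟩ := id hf
  exact MemLp.of_bound hf.continuous.aestronglyMeasurable C (Eventually.of_forall h1)

end IsBoundedLipschitz

section Energy

variable {d : ℕ} {α : ℝ} {f g : EuclideanSpace ℝ (Fin d) → ℝ}
  {μ : Measure (EuclideanSpace ℝ (Fin d))}

lemma integrable_prod_stableLevy_of_abs_le (hd : 0 < d) (hα : α ∈ Ioo (1 : ℝ) 2)
    [IsFiniteMeasure μ] {F : EuclideanSpace ℝ (Fin d) × EuclideanSpace ℝ (Fin d) → ℝ}
    (hF : Continuous F) {C : ℝ} (hC : ∀ p, |F p| ≤ C * min ‖p.2‖ (‖p.2‖ ^ 2)) :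
    Integrable F (μ.prod (stableLevy d α)) :=
  (((integrable_min_norm_stableLevy hd hα).const_mul C).comp_snd μ).mono'
    hF.aestronglyMeasurable (Eventually.of_forall hC)

lemma integrable_increment_mul (hd : 0 < d) (hα : α ∈ Ioo (1 : ℝ) 2) [IsFiniteMeasure μ]
    (hf : IsBoundedLipschitz f) (hg : IsBoundedLipschitz g) :
    Integrable (fun p : EuclideanSpace ℝ (Fin d) × EuclideanSpace ℝ (Fin d) =>
      (f (p.1 + p.2) - f p.1) * (g (p.1 + p.2) - g p.1)) (μ.prod (stableLevy d α)) := by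
  obtain ⟨C, h0, h1⟩ := hf.exists_abs_increment_le
  obtain ⟨C', h0', h1'⟩ := hg.exists_abs_increment_le
  have hfc := hf.continuous
  have hgc := hg.continuous
  refine integrable_prod_stableLevy_of_abs_le hd hα (by fun_prop) (C := C * C') fun p => ?_
  rw [abs_mul]
  refine (mul_le_mul (h1 _ _) (h1' _ _) (abs_nonneg _) (by positivity)).trans ?_
  rw [mul_mul_mul_comm]
  refine mul_le_mul_of_nonneg_left ?_ (by positivity)
  have hn := norm_nonneg p.2
  rcases le_total ‖p.2‖ 1 with h | h
  · rw [min_eq_left h]; exact le_min (by nlinarith) (by nlinarith)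
  · rw [min_eq_right h]; exact le_min (by nlinarith) (by nlinarith)

/-- The bilinear form polarizing the energy. -/
def energyForm (α : ℝ) (μ : Measure (EuclideanSpace ℝ (Fin d)))
    (f g : EuclideanSpace ℝ (Fin d) → ℝ) : ℝ :=
  ∫ p : EuclideanSpace ℝ (Fin d) × EuclideanSpace ℝ (Fin d),
    (f (p.1 + p.2) - f p.1) * (g (p.1 + p.2) - g p.1) ∂(μ.prod (stableLevy d α))

lemma energyForm_self_nonneg : 0 ≤ energyForm α μ f f :=
  integral_nonneg fun _ => mul_self_nonneg _

lemma Dform_eq_ofReal_energyForm (hd : 0 < d) (hα : α ∈ Ioo (1 : ℝ) 2) [IsFiniteMeasure μ]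
    (hf : IsBoundedLipschitz f) :
    Dform (stableLevy d α) μ f = ENNReal.ofReal (energyForm α μ f f) := by
  have hfc := hf.continuous
  unfold Dform energyForm
  rw [ofReal_integral_eq_lintegral_ofReal (integrable_increment_mul hd hα hf hf)
    (Eventually.of_forall fun _ => mul_self_nonneg _), lintegral_prod _ (by fun_prop)]
  simp only [pow_two]

lemma integral_integral_sq_increment (hd : 0 < d) (hα : α ∈ Ioo (1 : ℝ) 2) [IsFiniteMeasure μ]
    (hf : IsBoundedLipschitz f) :
    ∫ x, ∫ u, (f (x + u) - f x) ^ 2 ∂(stableLevy d α) ∂μ = energyForm α μ f f := by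
  unfold energyForm
  rw [integral_prod _ (integrable_increment_mul hd hα hf hf)]
  simp only [pow_two]

lemma eq_const_of_energyForm_eq_zero (hd : 0 < d) (hα : α ∈ Ioo (1 : ℝ) 2)
    [IsProbabilityMeasure μ] (hf : IsBoundedLipschitz f) (h : energyForm α μ f f = 0) :
    ∃ c, f = fun _ => c := by
  unfold energyForm at h
  rw [integral_eq_zero_iff_of_nonneg (fun _ => mul_self_nonneg _)
    (integrable_increment_mul hd hα hf hf)] at h
  obtain ⟨x, hx⟩ := (Measure.ae_ae_of_ae_prod h).exists
  have hx' : (fun u => f (x + u)) =ᵐ[volume] fun _ => f x := by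
    filter_upwards [(volume_absolutelyContinuous_stableLevy hd hα).ae_le hx] with u hu
    simpa [sub_eq_zero] using hu
  have hfc := hf.continuous
  have := (Continuous.ae_eq_iff_eq volume (by fun_prop) (by fun_prop)).1 hx'
  refine ⟨f x, funext fun y => ?_⟩
  simpa using congrFun this (y - x)

lemma variance_le_energyForm (hd : 0 < d) (hα : α ∈ Ioo (1 : ℝ) 2) [IsProbabilityMeasure μ]
    (hU : Ufun (stableLevy d α) μ = 1) (hf : IsBoundedLipschitz f) :
    variance f μ ≤ energyForm α μ f f := by
  rcases (energyForm_self_nonneg (f := f) (μ := μ) (α := α)).eq_or_lt with h | h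
  · obtain ⟨c, rfl⟩ := eq_const_of_energyForm_eq_zero hd hα hf h.symm
    rw [← h]
    simp [variance_eq_integral aemeasurable_const]
  · have hD := Dform_eq_ofReal_energyForm (μ := μ) hd hα hf
    unfold Ufun at hU
    have hbdd := not_imp_comm.1 Real.sSup_of_not_bddAbove (hU.trans_ne one_ne_zero)
    have := hU ▸ le_csSup hbdd ⟨f, hf.continuous.measurable, (hf.memLp).evariance_lt_top,
      by rw [hD]; exact ENNReal.ofReal_pos.2 h, by rw [hD]; exact ENNReal.ofReal_lt_top, rfl⟩
    rwa [hD, ENNReal.toReal_ofReal h.le, div_le_one h] at this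

lemma energyForm_add_smul_self (hd : 0 < d) (hα : α ∈ Ioo (1 : ℝ) 2) [IsFiniteMeasure μ]
    (hf : IsBoundedLipschitz f) (hg : IsBoundedLipschitz g) (t : ℝ) :
    energyForm α μ (f + t • g) (f + t • g) =
      energyForm α μ g g * (t * t) + 2 * energyForm α μ f g * t + energyForm α μ f f := by
  have iff := integrable_increment_mul (μ := μ) hd hα hf hf
  have ifg := integrable_increment_mul (μ := μ) hd hα hf hg
  have igg := integrable_increment_mul (μ := μ) hd hα hg hg
  have h1 := integral_add (igg.mul_const (t * t)) ((ifg.const_mul 2).mul_const t)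
  have h2 := integral_add ((igg.mul_const (t * t)).add ((ifg.const_mul 2).mul_const t)) iff
  simp only [Pi.add_apply] at h2
  rw [h1] at h2
  simp only [integral_mul_const, integral_const_mul] at h2
  unfold energyForm
  rw [← h2]
  congr 1 with p
  simp only [Pi.add_apply, Pi.smul_apply, smul_eq_mul]
  ring

lemma sq_energyForm_sub_covariance_le (hd : 0 < d) (hα : α ∈ Ioo (1 : ℝ) 2)
    [IsProbabilityMeasure μ] (hU : Ufun (stableLevy d α) μ = 1)
    (hf : IsBoundedLipschitz f) (hg : IsBoundedLipschitz g) :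
    (energyForm α μ f g - covariance f g μ) ^ 2 ≤
      (energyForm α μ f f - variance f μ) * (energyForm α μ g g - variance g μ) := by
  have key : ∀ t : ℝ, 0 ≤ (energyForm α μ g g - variance g μ) * (t * t) +
      2 * (energyForm α μ f g - covariance f g μ) * t +
        (energyForm α μ f f - variance f μ) := by
    intro t
    have h := variance_le_energyForm hd hα hU (hf.add (hg.const_smul t))
    rw [energyForm_add_smul_self hd hα hf hg, variance_add hf.memLp (hg.const_smul t).memLp,
      covariance_smul_right, variance_smul] at h
    linarith
  have := discrim_le_zero key
  unfold discrim at this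
  linarith

lemma tendsto_energyForm_sub_covariance (hd : 0 < d) (hα : α ∈ Ioo (1 : ℝ) 2)
    [IsProbabilityMeasure μ] (hU : Ufun (stableLevy d α) μ = 1)
    {ι : Type*} {l : Filter ι} {F : ι → EuclideanSpace ℝ (Fin d) → ℝ}
    (hF : ∀ᶠ i in l, IsBoundedLipschitz (F i))
    (hlim : Tendsto (fun i => variance (F i) μ - energyForm α μ (F i) (F i)) l (𝓝 0))
    (hg : IsBoundedLipschitz g) :
    Tendsto (fun i => energyForm α μ (F i) g - covariance (F i) g μ) l (𝓝 0) := by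
  have h1 : Tendsto (fun i => (energyForm α μ (F i) (F i) - variance (F i) μ) *
      (energyForm α μ g g - variance g μ)) l (𝓝 0) := by
    have := hlim.neg.mul_const (energyForm α μ g g - variance g μ)
    simpa using this
  have h2 : Tendsto (fun i => (energyForm α μ (F i) g - covariance (F i) g μ) ^ 2) l (𝓝 0) := by
    refine tendsto_of_tendsto_of_tendsto_of_le_of_le' tendsto_const_nhds h1
      (Eventually.of_forall fun _ => sq_nonneg _) ?_
    filter_upwards [hF] with i hi
    exact sq_energyForm_sub_covariance_le hd hα hU hi hg
  have h3 := h2.sqrt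
  simp only [Real.sqrt_sq_eq_abs, Real.sqrt_zero] at h3
  exact (tendsto_zero_iff_abs_tendsto_zero _).2 h3

end Energy

/-! ### The truncated coordinates -/

lemma mul_exp_neg_sq_sub_le {s t : ℝ} (ht : 0 ≤ t) (hts : t ≤ s) :
    t * (Real.exp (-t ^ 2) - Real.exp (-s ^ 2)) ≤ 3 * (s - t) := by
  rcases le_total s (2 * t) with h | h
  · have e : Real.exp (-s ^ 2) = Real.exp (-t ^ 2) * Real.exp (-(s ^ 2 - t ^ 2)) := by
      rw [← Real.exp_add]; congr 1; ring
    have h1 := Real.one_sub_le_exp_neg (s ^ 2 - t ^ 2)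
    have h2 : t ^ 2 * Real.exp (-t ^ 2) ≤ 1 :=
      (Real.mul_exp_neg_le_exp_neg_one _).trans (Real.exp_le_one_iff.2 (by norm_num))
    have h3 := Real.exp_pos (-t ^ 2)
    have hst : 0 ≤ s - t := by linarith
    calc t * (Real.exp (-t ^ 2) - Real.exp (-s ^ 2))
        = t * Real.exp (-t ^ 2) * (1 - Real.exp (-(s ^ 2 - t ^ 2))) := by rw [e]; ring
      _ ≤ t * Real.exp (-t ^ 2) * ((s - t) * (3 * t)) := by
          refine mul_le_mul_of_nonneg_left ?_ (by positivity)
          nlinarith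
      _ = 3 * (s - t) * (t ^ 2 * Real.exp (-t ^ 2)) := by ring
      _ ≤ 3 * (s - t) * 1 := mul_le_mul_of_nonneg_left h2 (by positivity)
      _ = 3 * (s - t) := mul_one _
  · have h1 : Real.exp (-t ^ 2) ≤ 1 := Real.exp_le_one_iff.2 (by nlinarith)
    have h2 := Real.exp_pos (-s ^ 2)
    nlinarith

lemma abs_gTrunc_one_sub_le {d : ℕ} (j : Fin d) (x y : EuclideanSpace ℝ (Fin d)) :
    |gTrunc 1 j x - gTrunc 1 j y| ≤ 4 * ‖x - y‖ := by
  wlog hxy : ‖y‖ ≤ ‖x‖ generalizing x y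
  · rw [abs_sub_comm, norm_sub_rev]
    exact this y x (le_of_not_ge hxy)
  simp only [gTrunc, inv_one, one_smul]
  have hj : |x j - y j| ≤ ‖x - y‖ := PiLp.norm_apply_le (x - y) j
  have hy : |y j| ≤ ‖y‖ := PiLp.norm_apply_le y j
  have h1 : Real.exp (-‖x‖ ^ 2) ≤ 1 := Real.exp_le_one_iff.2 (by nlinarith [norm_nonneg x])
  have h2 : Real.exp (-‖x‖ ^ 2) ≤ Real.exp (-‖y‖ ^ 2) :=
    Real.exp_le_exp.2 (by nlinarith [norm_nonneg y])
  have h3 := mul_exp_neg_sq_sub_le (norm_nonneg y) hxy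
  have h4 := norm_sub_norm_le x y
  have h5 : |x j - y j| * Real.exp (-‖x‖ ^ 2) ≤ ‖x - y‖ :=
    (mul_le_of_le_one_right (abs_nonneg _) h1).trans hj
  have h6 : |y j| * (Real.exp (-‖y‖ ^ 2) - Real.exp (-‖x‖ ^ 2)) ≤ 3 * (‖x‖ - ‖y‖) :=
    (mul_le_mul_of_nonneg_right hy (sub_nonneg.2 h2)).trans h3
  calc |x j * Real.exp (-‖x‖ ^ 2) - y j * Real.exp (-‖y‖ ^ 2)|
      = |(x j - y j) * Real.exp (-‖x‖ ^ 2) +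
          y j * (Real.exp (-‖x‖ ^ 2) - Real.exp (-‖y‖ ^ 2))| := by congr 1; ring
    _ ≤ |x j - y j| * Real.exp (-‖x‖ ^ 2) +
          |y j| * (Real.exp (-‖y‖ ^ 2) - Real.exp (-‖x‖ ^ 2)) := by
        refine (abs_add_le _ _).trans_eq ?_
        rw [abs_mul, abs_mul, abs_of_pos (Real.exp_pos _),
          abs_sub_comm (Real.exp (-‖x‖ ^ 2)), abs_of_nonneg (sub_nonneg.2 h2)]
    _ ≤ 4 * ‖x - y‖ := by linarith

lemma gTrunc_eq_mul {d : ℕ} {R : ℝ} (hR : 0 < R) (j : Fin d) (x : EuclideanSpace ℝ (Fin d)) :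
    gTrunc R j x = R * gTrunc 1 j (R⁻¹ • x) := by
  simp only [gTrunc, inv_one, one_smul, PiLp.smul_apply, smul_eq_mul]
  field_simp

lemma abs_gTrunc_sub_le {d : ℕ} {R : ℝ} (hR : 0 < R) (j : Fin d)
    (x y : EuclideanSpace ℝ (Fin d)) : |gTrunc R j x - gTrunc R j y| ≤ 4 * ‖x - y‖ := by
  rw [gTrunc_eq_mul hR, gTrunc_eq_mul hR, ← mul_sub, abs_mul, abs_of_pos hR]
  refine (mul_le_mul_of_nonneg_left (abs_gTrunc_one_sub_le j _ _) hR.le).trans_eq ?_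
  rw [← smul_sub, norm_smul, norm_inv, Real.norm_of_nonneg hR.le]
  field_simp

lemma abs_gTrunc_le_norm {d : ℕ} (R : ℝ) (j : Fin d) (x : EuclideanSpace ℝ (Fin d)) :
    |gTrunc R j x| ≤ ‖x‖ := by
  rw [gTrunc, abs_mul, abs_of_pos (Real.exp_pos _)]
  exact (mul_le_of_le_one_right (abs_nonneg _)
    (Real.exp_le_one_iff.2 (by nlinarith [norm_nonneg (R⁻¹ • x)]))).trans (PiLp.norm_apply_le x j)

lemma abs_gTrunc_one_le {d : ℕ} (j : Fin d) (x : EuclideanSpace ℝ (Fin d)) :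
    |gTrunc 1 j x| ≤ 1 := by
  rcases le_total ‖x‖ 1 with h | h
  · exact (abs_gTrunc_le_norm 1 j x).trans h
  · rw [gTrunc, abs_mul, abs_of_pos (Real.exp_pos _), inv_one, one_smul]
    have h2 : ‖x‖ ^ 2 * Real.exp (-‖x‖ ^ 2) ≤ 1 :=
      (Real.mul_exp_neg_le_exp_neg_one _).trans (Real.exp_le_one_iff.2 (by norm_num))
    have hj : |x j| ≤ ‖x‖ := PiLp.norm_apply_le x j
    refine le_trans (mul_le_mul_of_nonneg_right (hj.trans ?_) (Real.exp_pos _).le) h2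
    nlinarith

lemma isBoundedLipschitz_gTrunc {d : ℕ} {R : ℝ} (hR : 0 < R) (j : Fin d) :
    IsBoundedLipschitz (gTrunc R j) := by
  refine ⟨4 + R, by positivity, fun x => ?_, fun x y => ?_⟩
  · rw [gTrunc_eq_mul hR, abs_mul, abs_of_pos hR]
    have := abs_gTrunc_one_le j (R⁻¹ • x)
    nlinarith
  · have := abs_gTrunc_sub_le hR j x y
    nlinarith [norm_nonneg (x - y)]

lemma tendsto_gTrunc {d : ℕ} (j : Fin d) (x : EuclideanSpace ℝ (Fin d)) :
    Tendsto (fun R : ℝ => gTrunc R j x) atTop (𝓝 (x j)) := by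
  have h : Tendsto (fun R : ℝ => R⁻¹ • x) atTop (𝓝 ((0 : ℝ) • x)) :=
    tendsto_inv_atTop_zero.smul_const x
  have h2 := ((h.norm.pow 2).neg.rexp).const_mul (x j)
  simpa [gTrunc] using h2

/-! ### The Stein-type identity -/

section Stein

variable {d : ℕ} {α : ℝ} {g : EuclideanSpace ℝ (Fin d) → ℝ}
  {μ : Measure (EuclideanSpace ℝ (Fin d))}

lemma tendsto_covariance_gTrunc [IsProbabilityMeasure μ]
    (hint : Integrable (fun x : EuclideanSpace ℝ (Fin d) => x) μ) (hcentered : ∫ x, x ∂μ = 0)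
    (hg : IsBoundedLipschitz g) (j : Fin d) :
    Tendsto (fun R : ℝ => covariance (gTrunc R j) g μ) atTop (𝓝 (∫ x, x j * g x ∂μ)) := by
  obtain ⟨C, hC0, hC, -⟩ := id hg
  have hgc := hg.continuous
  have hj0 : ∫ x : EuclideanSpace ℝ (Fin d), x j ∂μ = 0 := by
    have := (EuclideanSpace.proj (𝕜 := ℝ) j).integral_comp_comm hint
    rw [hcentered, map_zero] at this
    exact this
  have hcont : ∀ᶠ R : ℝ in atTop, Continuous (gTrunc (d := d) R j) := by
    filter_upwards [eventually_gt_atTop 0] with R hR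
    exact (isBoundedLipschitz_gTrunc hR j).continuous
  have t1 : Tendsto (fun R : ℝ => ∫ x, gTrunc R j x * g x ∂μ) atTop
      (𝓝 (∫ x, x j * g x ∂μ)) := by
    refine tendsto_integral_filter_of_dominated_convergence (fun x => ‖x‖ * C) ?_ ?_
      (hint.norm.mul_const C) ?_
    · filter_upwards [hcont] with R hR
      exact (hR.mul hgc).aestronglyMeasurable
    · refine Eventually.of_forall fun R => Eventually.of_forall fun x => ?_
      rw [Real.norm_eq_abs, abs_mul]
      exact mul_le_mul (abs_gTrunc_le_norm R j x) (hC x) (abs_nonneg _) (norm_nonneg _)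
    · exact Eventually.of_forall fun x => (tendsto_gTrunc j x).mul_const _
  have t2 : Tendsto (fun R : ℝ => ∫ x, gTrunc R j x ∂μ) atTop (𝓝 0) := by
    rw [← hj0]
    refine tendsto_integral_filter_of_dominated_convergence (fun x => ‖x‖) ?_ ?_ hint.norm ?_
    · filter_upwards [hcont] with R hR
      exact hR.aestronglyMeasurable
    · exact Eventually.of_forall fun R => Eventually.of_forall fun x => abs_gTrunc_le_norm R j x
    · exact Eventually.of_forall fun x => tendsto_gTrunc j x
  have t3 := t1.sub (t2.mul_const (∫ x, g x ∂μ))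
  rw [zero_mul, sub_zero] at t3
  refine t3.congr' ?_
  filter_upwards [eventually_gt_atTop 0] with R hR
  rw [covariance_eq_sub (isBoundedLipschitz_gTrunc hR j).memLp hg.memLp]
  rfl

lemma abs_mul_increment_le (hg : IsBoundedLipschitz g) :
    ∃ C : ℝ, 0 ≤ C ∧ ∀ x u, ‖u‖ * |g (x + u) - g x| ≤ C * min ‖u‖ (‖u‖ ^ 2) := by
  obtain ⟨C, h0, h1⟩ := hg.exists_abs_increment_le
  refine ⟨C, h0, fun x u => (mul_le_mul_of_nonneg_left (h1 x u) (norm_nonneg u)).trans_eq ?_⟩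
  rw [mul_left_comm, mul_min_of_nonneg _ _ (norm_nonneg u), mul_one, ← pow_two, min_comm]

lemma integrable_coord_mul_increment (hd : 0 < d) (hα : α ∈ Ioo (1 : ℝ) 2) [IsFiniteMeasure μ]
    (hg : IsBoundedLipschitz g) (j : Fin d) :
    Integrable (fun p : EuclideanSpace ℝ (Fin d) × EuclideanSpace ℝ (Fin d) =>
      p.2 j * (g (p.1 + p.2) - g p.1)) (μ.prod (stableLevy d α)) := by
  obtain ⟨C, -, hC⟩ := abs_mul_increment_le hg
  have hgc := hg.continuous
  refine integrable_prod_stableLevy_of_abs_le hd hα (by fun_prop) (C := C) fun p => ?_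
  rw [abs_mul]
  exact (mul_le_mul_of_nonneg_right (PiLp.norm_apply_le p.2 j) (abs_nonneg _)).trans (hC p.1 p.2)

lemma tendsto_energyForm_gTrunc (hd : 0 < d) (hα : α ∈ Ioo (1 : ℝ) 2) [IsProbabilityMeasure μ]
    (hg : IsBoundedLipschitz g) (j : Fin d) :
    Tendsto (fun R : ℝ => energyForm α μ (gTrunc R j) g) atTop
      (𝓝 (∫ p : EuclideanSpace ℝ (Fin d) × EuclideanSpace ℝ (Fin d),
        p.2 j * (g (p.1 + p.2) - g p.1) ∂(μ.prod (stableLevy d α)))) := by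
  obtain ⟨C, hC0, hC⟩ := abs_mul_increment_le hg
  have hgc := hg.continuous
  refine tendsto_integral_filter_of_dominated_convergence
    (fun p => 4 * C * min ‖p.2‖ (‖p.2‖ ^ 2)) ?_ ?_
    (((integrable_min_norm_stableLevy hd hα).const_mul (4 * C)).comp_snd μ) ?_
  · filter_upwards [eventually_gt_atTop 0] with R hR
    have := (isBoundedLipschitz_gTrunc hR j).continuous
    exact Continuous.aestronglyMeasurable (by fun_prop)
  · filter_upwards [eventually_gt_atTop 0] with R hR
    refine Eventually.of_forall fun p => ?_
    have h := abs_gTrunc_sub_le hR j (p.1 + p.2) p.1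
    rw [add_sub_cancel_left] at h
    rw [Real.norm_eq_abs, abs_mul]
    refine (mul_le_mul_of_nonneg_right h (abs_nonneg _)).trans ?_
    have := hC p.1 p.2
    linarith
  · refine Eventually.of_forall fun p => ?_
    have h := ((tendsto_gTrunc j (p.1 + p.2)).sub (tendsto_gTrunc j p.1)).mul_const
      (g (p.1 + p.2) - g p.1)
    simpa using h

lemma integral_coord_mul_eq (hd : 0 < d) (hα : α ∈ Ioo (1 : ℝ) 2) [IsProbabilityMeasure μ]
    (hint : Integrable (fun x : EuclideanSpace ℝ (Fin d) => x) μ) (hcentered : ∫ x, x ∂μ = 0)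
    (hU : Ufun (stableLevy d α) μ = 1) (hg : IsBoundedLipschitz g) {j : Fin d}
    (hweyl : Tendsto (fun R : ℝ => variance (gTrunc R j) μ -
      ∫ x, ∫ u, (gTrunc R j (x + u) - gTrunc R j x) ^ 2 ∂(stableLevy d α) ∂μ) atTop (𝓝 0)) :
    ∫ x, x j * g x ∂μ =
      ∫ p : EuclideanSpace ℝ (Fin d) × EuclideanSpace ℝ (Fin d),
        p.2 j * (g (p.1 + p.2) - g p.1) ∂(μ.prod (stableLevy d α)) := by
  have hF : ∀ᶠ R : ℝ in atTop, IsBoundedLipschitz (gTrunc (d := d) R j) := by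
    filter_upwards [eventually_gt_atTop 0] with R hR
    exact isBoundedLipschitz_gTrunc hR j
  have hlim : Tendsto (fun R : ℝ => variance (gTrunc R j) μ -
      energyForm α μ (gTrunc R j) (gTrunc R j)) atTop (𝓝 0) := by
    refine hweyl.congr' ?_
    filter_upwards [hF] with R hR
    rw [integral_integral_sq_increment (μ := μ) hd hα hR]
  have h1 := tendsto_energyForm_sub_covariance hd hα hU hF hlim hg
  have h2 := (tendsto_energyForm_gTrunc (μ := μ) hd hα hg j).sub
    (tendsto_covariance_gTrunc hint hcentered hg j)
  exact (sub_eq_zero.1 (tendsto_nhds_unique h2 h1)).symm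

lemma integral_inner_mul_eq (hd : 0 < d) (hα : α ∈ Ioo (1 : ℝ) 2) [IsProbabilityMeasure μ]
    (hint : Integrable (fun x : EuclideanSpace ℝ (Fin d) => x) μ) (hcentered : ∫ x, x ∂μ = 0)
    (hU : Ufun (stableLevy d α) μ = 1) (hg : IsBoundedLipschitz g)
    (hweyl : ∀ j : Fin d, Tendsto (fun R : ℝ => variance (gTrunc R j) μ -
      ∫ x, ∫ u, (gTrunc R j (x + u) - gTrunc R j x) ^ 2 ∂(stableLevy d α) ∂μ) atTop (𝓝 0))
    (ξ : EuclideanSpace ℝ (Fin d)) :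
    ∫ x, ⟪ξ, x⟫ * g x ∂μ =
      ∫ p : EuclideanSpace ℝ (Fin d) × EuclideanSpace ℝ (Fin d),
        ⟪ξ, p.2⟫ * (g (p.1 + p.2) - g p.1) ∂(μ.prod (stableLevy d α)) := by
  obtain ⟨C, -, hC, -⟩ := id hg
  have hgc := hg.continuous
  have hinner : ∀ x : EuclideanSpace ℝ (Fin d), ⟪ξ, x⟫ = ∑ j, ξ j * x j := fun x => by
    rw [PiLp.inner_apply]
    exact Finset.sum_congr rfl fun j _ => mul_comm _ _
  have hi : ∀ j : Fin d, Integrable (fun x : EuclideanSpace ℝ (Fin d) => x j * g x) μ := fun j =>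
    ((EuclideanSpace.proj (𝕜 := ℝ) j).integrable_comp hint).mul_bdd
      hgc.aestronglyMeasurable (Eventually.of_forall hC)
  simp_rw [hinner, Finset.sum_mul, mul_assoc]
  rw [integral_finsetSum _ fun j _ => (hi j).const_mul _,
    integral_finsetSum _ fun j _ => (integrable_coord_mul_increment hd hα hg j).const_mul _]
  refine Finset.sum_congr rfl fun j _ => ?_
  rw [integral_const_mul, integral_const_mul,
    integral_coord_mul_eq hd hα hint hcentered hU hg (hweyl j)]

end Stein

/-! ### Trigonometric test functions and the characteristic function -/

section CharFn

variable {d : ℕ} {α : ℝ} {μ : Measure (EuclideanSpace ℝ (Fin d))}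

lemma isBoundedLipschitz_comp_inner {h : ℝ → ℝ} (h1 : ∀ a, |h a| ≤ 1)
    (h2 : ∀ a b, |h a - h b| ≤ |a - b|) (t : ℝ) (ξ : EuclideanSpace ℝ (Fin d)) :
    IsBoundedLipschitz fun x : EuclideanSpace ℝ (Fin d) => h (t * ⟪ξ, x⟫) := by
  have h0 : 0 ≤ |t| * ‖ξ‖ := by positivity
  refine ⟨1 + |t| * ‖ξ‖, by positivity, fun x => by linarith [h1 (t * ⟪ξ, x⟫)], fun x y => ?_⟩
  refine (h2 _ _).trans ?_
  rw [← mul_sub, ← inner_sub_right, abs_mul]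
  have := mul_le_mul_of_nonneg_left (abs_real_inner_le_norm ξ (x - y)) (abs_nonneg t)
  nlinarith [norm_nonneg (x - y)]

lemma isBoundedLipschitz_cos_inner (t : ℝ) (ξ : EuclideanSpace ℝ (Fin d)) :
    IsBoundedLipschitz fun x : EuclideanSpace ℝ (Fin d) => Real.cos (t * ⟪ξ, x⟫) :=
  isBoundedLipschitz_comp_inner Real.abs_cos_le_one Real.abs_cos_sub_cos_le t ξ

lemma isBoundedLipschitz_sin_inner (t : ℝ) (ξ : EuclideanSpace ℝ (Fin d)) :
    IsBoundedLipschitz fun x : EuclideanSpace ℝ (Fin d) => Real.sin (t * ⟪ξ, x⟫) :=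
  isBoundedLipschitz_comp_inner Real.abs_sin_le_one Real.abs_sin_sub_sin_le t ξ

lemma le_add_mul_min_norm {E : Type*} [SeminormedAddCommGroup E] {a A B : ℝ} {u : E}
    (hA : 0 ≤ A) (hB : 0 ≤ B) (h1 : a ≤ A * ‖u‖) (h2 : a ≤ B * ‖u‖ ^ 2) :
    a ≤ (A + B) * min ‖u‖ (‖u‖ ^ 2) := by
  have := norm_nonneg u
  rcases min_cases ‖u‖ (‖u‖ ^ 2) with ⟨h, -⟩ | ⟨h, -⟩ <;> rw [h]
  · nlinarith
  · nlinarith [sq_nonneg ‖u‖]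

lemma abs_inner_mul_sin_le (t : ℝ) (ξ u : EuclideanSpace ℝ (Fin d)) :
    |⟪ξ, u⟫ * Real.sin (t * ⟪ξ, u⟫)| ≤
      (‖ξ‖ + |t| * ‖ξ‖ ^ 2) * min ‖u‖ (‖u‖ ^ 2) := by
  have hi := abs_real_inner_le_norm ξ u
  rw [abs_mul]
  refine le_add_mul_min_norm (by positivity) (by positivity) ?_ ?_
  · exact (mul_le_of_le_one_right (abs_nonneg _) (Real.abs_sin_le_one _)).trans hi
  · have h1 : |Real.sin (t * ⟪ξ, u⟫)| ≤ |t| * (‖ξ‖ * ‖u‖) := by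
      refine Real.abs_sin_le_abs.trans ?_
      rw [abs_mul]
      exact mul_le_mul_of_nonneg_left hi (abs_nonneg t)
    refine (mul_le_mul hi h1 (abs_nonneg _) (by positivity)).trans_eq ?_
    ring

lemma abs_inner_mul_cos_sub_one_le (t : ℝ) (ξ u : EuclideanSpace ℝ (Fin d)) :
    |⟪ξ, u⟫ * (Real.cos (t * ⟪ξ, u⟫) - 1)| ≤
      (2 * ‖ξ‖ + |t| * ‖ξ‖ ^ 2) * min ‖u‖ (‖u‖ ^ 2) := by
  have hi := abs_real_inner_le_norm ξ u
  rw [abs_mul]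
  refine le_add_mul_min_norm (by positivity) (by positivity) ?_ ?_
  · have : |Real.cos (t * ⟪ξ, u⟫) - 1| ≤ 2 := by
      rw [abs_le]
      constructor <;> linarith [Real.cos_le_one (t * ⟪ξ, u⟫), Real.neg_one_le_cos (t * ⟪ξ, u⟫)]
    refine (mul_le_mul hi this (abs_nonneg _) (by positivity)).trans_eq ?_
    ring
  · have h1 : |Real.cos (t * ⟪ξ, u⟫) - 1| ≤ |t| * (‖ξ‖ * ‖u‖) := by
      have := Real.abs_cos_sub_cos_le (t * ⟪ξ, u⟫) 0
      rw [Real.cos_zero, sub_zero, abs_mul] at this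
      exact this.trans (mul_le_mul_of_nonneg_left hi (abs_nonneg t))
    refine (mul_le_mul hi h1 (abs_nonneg _) (by positivity)).trans_eq ?_
    ring

lemma abs_one_sub_cos_le (t : ℝ) (ξ u : EuclideanSpace ℝ (Fin d)) :
    |1 - Real.cos (t * ⟪ξ, u⟫)| ≤
      (|t| * ‖ξ‖ + t ^ 2 * ‖ξ‖ ^ 2) * min ‖u‖ (‖u‖ ^ 2) := by
  have hi := abs_real_inner_le_norm ξ u
  refine le_add_mul_min_norm (by positivity) (by positivity) ?_ ?_
  · have := Real.abs_cos_sub_cos_le 0 (t * ⟪ξ, u⟫)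
    rw [Real.cos_zero, zero_sub, abs_neg, abs_mul] at this
    exact this.trans ((mul_le_mul_of_nonneg_left hi (abs_nonneg t)).trans_eq (by ring))
  · rw [abs_of_nonneg (sub_nonneg.2 (Real.cos_le_one _))]
    have h1 := Real.one_sub_sq_div_two_le_cos (x := t * ⟪ξ, u⟫)
    have h2 : ⟪ξ, u⟫ ^ 2 ≤ (‖ξ‖ * ‖u‖) ^ 2 :=
      sq_le_sq.2 (hi.trans (le_abs_self _))
    have h3 := mul_le_mul_of_nonneg_left h2 (sq_nonneg t)
    nlinarith [sq_nonneg (t * ⟪ξ, u⟫)]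

lemma integrable_stableLevy_of_abs_le (hd : 0 < d) (hα : α ∈ Ioo (1 : ℝ) 2)
    {F : EuclideanSpace ℝ (Fin d) → ℝ} (hF : Continuous F) {C : ℝ}
    (hC : ∀ u, |F u| ≤ C * min ‖u‖ (‖u‖ ^ 2)) : Integrable F (stableLevy d α) :=
  ((integrable_min_norm_stableLevy hd hα).const_mul C).mono'
    hF.aestronglyMeasurable (Eventually.of_forall hC)

lemma integral_inner_mul_cos_sub_one_stableLevy (t : ℝ) (ξ : EuclideanSpace ℝ (Fin d)) :
    ∫ u, ⟪ξ, u⟫ * (Real.cos (t * ⟪ξ, u⟫) - 1) ∂(stableLevy d α) = 0 := by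
  unfold stableLevy
  rw [integral_withDensity_eq_integral_toReal_smul (by fun_prop) (by simp)]
  have h := integral_neg_eq_self (fun u : EuclideanSpace ℝ (Fin d) =>
    (ENNReal.ofReal (stableCst d α / ‖u‖ ^ ((d : ℝ) + α))).toReal •
      (⟪ξ, u⟫ * (Real.cos (t * ⟪ξ, u⟫) - 1))) volume
  simp only [norm_neg, inner_neg_right, mul_neg, Real.cos_neg, neg_mul, smul_neg,
    integral_neg] at h
  linarith

/-- The derivative at `t` of the Lévy exponent along the ray through `ξ`. -/
def rayDrift (α : ℝ) (ξ : EuclideanSpace ℝ (Fin d)) (t : ℝ) : ℝ :=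
  ∫ u, ⟪ξ, u⟫ * Real.sin (t * ⟪ξ, u⟫) ∂(stableLevy d α)

lemma integral_prod_inner_mul_add (hd : 0 < d) (hα : α ∈ Ioo (1 : ℝ) 2) [IsFiniteMeasure μ]
    {a b : EuclideanSpace ℝ (Fin d) → ℝ} {A : ℝ}
    (ha : Continuous a) (hb : Continuous b) (ha1 : ∀ x, |a x| ≤ A) (hb1 : ∀ x, |b x| ≤ A)
    (t : ℝ) (ξ : EuclideanSpace ℝ (Fin d)) :
    ∫ p : EuclideanSpace ℝ (Fin d) × EuclideanSpace ℝ (Fin d),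
        ⟪ξ, p.2⟫ * (a p.1 * (Real.cos (t * ⟪ξ, p.2⟫) - 1) + b p.1 * Real.sin (t * ⟪ξ, p.2⟫))
          ∂(μ.prod (stableLevy d α)) = (∫ x, b x ∂μ) * rayDrift α ξ t := by
  have i1 : Integrable (fun u => ⟪ξ, u⟫ * (Real.cos (t * ⟪ξ, u⟫) - 1)) (stableLevy d α) :=
    integrable_stableLevy_of_abs_le hd hα (by fun_prop) (abs_inner_mul_cos_sub_one_le t ξ)
  have i2 : Integrable (fun u => ⟪ξ, u⟫ * Real.sin (t * ⟪ξ, u⟫)) (stableLevy d α) :=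
    integrable_stableLevy_of_abs_le hd hα (by fun_prop) (abs_inner_mul_sin_le t ξ)
  have j1 : Integrable a μ :=
    Integrable.of_bound ha.aestronglyMeasurable A (Eventually.of_forall ha1)
  have j2 : Integrable b μ :=
    Integrable.of_bound hb.aestronglyMeasurable A (Eventually.of_forall hb1)
  have h := integral_add (j1.mul_prod i1) (j2.mul_prod i2)
  rw [integral_prod_mul a fun u => ⟪ξ, u⟫ * (Real.cos (t * ⟪ξ, u⟫) - 1),
    integral_prod_mul b fun u => ⟪ξ, u⟫ * Real.sin (t * ⟪ξ, u⟫),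
    integral_inner_mul_cos_sub_one_stableLevy, mul_zero, zero_add] at h
  rw [rayDrift, ← h]
  congr 1 with p
  ring

lemma hasDerivAt_levyExponent (hd : 0 < d) (hα : α ∈ Ioo (1 : ℝ) 2)
    (ξ : EuclideanSpace ℝ (Fin d)) (t : ℝ) :
    HasDerivAt (fun t : ℝ => ∫ u, (1 - Real.cos (t * ⟪ξ, u⟫)) ∂(stableLevy d α))
      (rayDrift α ξ t) t := by
  refine (hasDerivAt_integral_of_dominated_loc_of_deriv_le
    (bound := fun u => (‖ξ‖ + (|t| + 1) * ‖ξ‖ ^ 2) * min ‖u‖ (‖u‖ ^ 2))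
    (F' := fun t u => ⟪ξ, u⟫ * Real.sin (t * ⟪ξ, u⟫))
    (Metric.ball_mem_nhds t one_pos) ?_ ?_ ?_ ?_ ?_ ?_).2
  · exact Eventually.of_forall fun s => Continuous.aestronglyMeasurable (by fun_prop)
  · exact integrable_stableLevy_of_abs_le hd hα (by fun_prop) (abs_one_sub_cos_le t ξ)
  · exact Continuous.aestronglyMeasurable (by fun_prop)
  · refine Eventually.of_forall fun u s hs => (abs_inner_mul_sin_le s ξ u).trans ?_
    have : |s| ≤ |t| + 1 := by
      rw [Metric.mem_ball, Real.dist_eq] at hs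
      have := abs_sub_abs_le_abs_sub s t
      linarith
    gcongr
  · exact (integrable_min_norm_stableLevy hd hα).const_mul _
  · refine Eventually.of_forall fun u s _ => ?_
    have := ((hasDerivAt_mul_const (x := s) ⟪ξ, u⟫).cos).const_sub 1
    exact this.congr_deriv (by ring)

lemma hasDerivAt_integral_comp_inner [IsFiniteMeasure μ]
    (hint : Integrable (fun x : EuclideanSpace ℝ (Fin d) => x) μ) {h h' : ℝ → ℝ}
    (hh : ∀ a, HasDerivAt h (h' a) a) (hc' : Continuous h') (h1 : ∀ a, |h a| ≤ 1)
    (h1' : ∀ a, |h' a| ≤ 1) (ξ : EuclideanSpace ℝ (Fin d)) (t : ℝ) :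
    HasDerivAt (fun t : ℝ => ∫ x, h (t * ⟪ξ, x⟫) ∂μ) (∫ x, ⟪ξ, x⟫ * h' (t * ⟪ξ, x⟫) ∂μ) t := by
  have hc : Continuous h := continuous_iff_continuousAt.2 fun a => (hh a).continuousAt
  refine (hasDerivAt_integral_of_dominated_loc_of_deriv_le
    (bound := fun x => ‖ξ‖ * ‖x‖) (F' := fun t x => ⟪ξ, x⟫ * h' (t * ⟪ξ, x⟫))
    univ_mem ?_ ?_ ?_ ?_ ?_ ?_).2
  · exact Eventually.of_forall fun s => Continuous.aestronglyMeasurable (by fun_prop)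
  · exact Integrable.of_bound (Continuous.aestronglyMeasurable (by fun_prop)) 1
      (Eventually.of_forall fun x => h1 _)
  · exact Continuous.aestronglyMeasurable (by fun_prop)
  · refine Eventually.of_forall fun x s _ => ?_
    rw [Real.norm_eq_abs, abs_mul]
    exact (mul_le_of_le_one_right (abs_nonneg _) (h1' _)).trans (abs_real_inner_le_norm ξ x)
  · exact hint.norm.const_mul _
  · refine Eventually.of_forall fun x s _ => ?_
    have := (hh (s * ⟪ξ, x⟫)).comp s (hasDerivAt_mul_const (x := s) ⟪ξ, x⟫)
    exact this.congr_deriv (mul_comm _ _)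

lemma eq_mul_exp_neg_of_hasDerivAt {C ψ S : ℝ → ℝ}
    (hC : ∀ t, HasDerivAt C (-(C t * S t)) t) (hψ : ∀ t, HasDerivAt ψ (S t) t) (hψ0 : ψ 0 = 0)
    (t : ℝ) : C t = C 0 * Real.exp (-ψ t) := by
  have hd : ∀ t, HasDerivAt (fun t => C t * Real.exp (ψ t)) 0 t := fun t =>
    ((hC t).mul (hψ t).exp).congr_deriv (by ring)
  have h := is_const_of_deriv_eq_zero (fun t => (hd t).differentiableAt)
    (fun t => (hd t).deriv) t 0
  simp only [hψ0, Real.exp_zero, mul_one] at h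
  rw [← h, mul_assoc, ← Real.exp_add, add_neg_cancel, Real.exp_zero, mul_one]

lemma integral_one_sub_cos_stableLevy (hd : 0 < d) (hα : α ∈ Ioo (1 : ℝ) 2)
    (ξ : EuclideanSpace ℝ (Fin d)) :
    ∫ u, (1 - Real.cos ⟪ξ, u⟫) ∂(stableLevy d α) = ‖ξ‖ ^ α / 2 := by
  rw [integral_eq_lintegral_of_nonneg_ae
    (Eventually.of_forall fun u => sub_nonneg.2 (Real.cos_le_one _))
    (Continuous.aestronglyMeasurable (by fun_prop)), lintegral_one_sub_cos_stableLevy hd hα,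
    ENNReal.toReal_ofReal (by positivity)]

lemma charFn_eq_cos_add_sin [IsFiniteMeasure μ] (ξ : EuclideanSpace ℝ (Fin d)) :
    charFn μ ξ = ((∫ x, Real.cos ⟪ξ, x⟫ ∂μ : ℝ) : ℂ) +
      ((∫ x, Real.sin ⟪ξ, x⟫ ∂μ : ℝ) : ℂ) * Complex.I := by
  have j1 : Integrable (fun x => Real.cos ⟪ξ, x⟫) μ :=
    Integrable.of_bound (Continuous.aestronglyMeasurable (by fun_prop)) 1
      (Eventually.of_forall fun x => Real.abs_cos_le_one _)
  have j2 : Integrable (fun x => Real.sin ⟪ξ, x⟫) μ :=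
    Integrable.of_bound (Continuous.aestronglyMeasurable (by fun_prop)) 1
      (Eventually.of_forall fun x => Real.abs_sin_le_one _)
  have i1 : Integrable (fun x => ((Real.cos ⟪ξ, x⟫ : ℝ) : ℂ)) μ := j1.ofReal
  have i2 : Integrable (fun x => ((Real.sin ⟪ξ, x⟫ : ℝ) : ℂ)) μ := j2.ofReal
  rw [charFn, ← integral_complex_ofReal, ← integral_complex_ofReal, ← integral_mul_const,
    ← integral_add i1 (i2.mul_const _)]
  congr 1 with x
  rw [mul_comm, Complex.exp_mul_I, Complex.ofReal_cos, Complex.ofReal_sin]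

lemma charFn_eq_exp (hd : 0 < d) (hα : α ∈ Ioo (1 : ℝ) 2) [IsProbabilityMeasure μ]
    (hint : Integrable (fun x : EuclideanSpace ℝ (Fin d) => x) μ) (hcentered : ∫ x, x ∂μ = 0)
    (hU : Ufun (stableLevy d α) μ = 1)
    (hweyl : ∀ j : Fin d, Tendsto (fun R : ℝ => variance (gTrunc R j) μ -
      ∫ x, ∫ u, (gTrunc R j (x + u) - gTrunc R j x) ^ 2 ∂(stableLevy d α) ∂μ) atTop (𝓝 0))
    (ξ : EuclideanSpace ℝ (Fin d)) :
    charFn μ ξ = Complex.exp (-((‖ξ‖ ^ α / 2 : ℝ) : ℂ)) := by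
  have hψ := hasDerivAt_levyExponent hd hα ξ
  have hC : ∀ t, HasDerivAt (fun t => ∫ x, Real.cos (t * ⟪ξ, x⟫) ∂μ)
      (-((∫ x, Real.cos (t * ⟪ξ, x⟫) ∂μ) * rayDrift α ξ t)) t := fun t => by
    refine (hasDerivAt_integral_comp_inner hint Real.hasDerivAt_cos (by fun_prop)
      Real.abs_cos_le_one (fun a => by rw [abs_neg]; exact Real.abs_sin_le_one a)
      ξ t).congr_deriv ?_
    simp only [mul_neg, integral_neg]
    rw [integral_inner_mul_eq hd hα hint hcentered hU (isBoundedLipschitz_sin_inner t ξ) hweyl ξ,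
      ← integral_prod_inner_mul_add hd hα (a := fun x => Real.sin (t * ⟪ξ, x⟫))
        (b := fun x => Real.cos (t * ⟪ξ, x⟫)) (by fun_prop) (by fun_prop)
        (fun x => Real.abs_sin_le_one _) (fun x => Real.abs_cos_le_one _) t ξ]
    congr 2 with p
    rw [inner_add_right, mul_add, Real.sin_add]
    ring
  have hS : ∀ t, HasDerivAt (fun t => ∫ x, Real.sin (t * ⟪ξ, x⟫) ∂μ)
      (-((∫ x, Real.sin (t * ⟪ξ, x⟫) ∂μ) * rayDrift α ξ t)) t := fun t => by
    refine (hasDerivAt_integral_comp_inner hint Real.hasDerivAt_sin (by fun_prop)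
      Real.abs_sin_le_one Real.abs_cos_le_one ξ t).congr_deriv ?_
    rw [integral_inner_mul_eq hd hα hint hcentered hU (isBoundedLipschitz_cos_inner t ξ) hweyl ξ,
      ← neg_mul, ← integral_neg,
      ← integral_prod_inner_mul_add hd hα (a := fun x => Real.cos (t * ⟪ξ, x⟫))
        (b := fun x => -Real.sin (t * ⟪ξ, x⟫)) (by fun_prop) (by fun_prop)
        (fun x => Real.abs_cos_le_one _)
        (fun x => by rw [abs_neg]; exact Real.abs_sin_le_one _) t ξ]
    congr 1 with p
    rw [inner_add_right, mul_add, Real.cos_add]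
    ring
  have h1 := eq_mul_exp_neg_of_hasDerivAt hC hψ (by simp) 1
  have h2 := eq_mul_exp_neg_of_hasDerivAt hS hψ (by simp) 1
  simp only [one_mul, zero_mul, Real.cos_zero, Real.sin_zero, integral_const, smul_eq_mul,
    probReal_univ, mul_one, mul_zero, integral_one_sub_cos_stableLevy hd hα] at h1 h2
  rw [charFn_eq_cos_add_sin, h1, h2]
  simp

lemma charFun_eq_charFn (ξ : EuclideanSpace ℝ (Fin d)) : charFun μ ξ = charFn μ ξ := by
  rw [charFun_apply, charFn]
  congr 1 with x
  rw [mul_comm, real_inner_comm]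

end CharFn

/-- Rigidity, converse direction: if `U_α(μ) = 1` (together with the Weyl-type condition
along the optimizing sequence), then `μ` is the rotationally invariant `α`-stable law
(`cor:rigidity2`). -/
theorem stmt13 (d : ℕ) (hd : 0 < d) (α : ℝ) (hα : α ∈ Ioo (1 : ℝ) 2)
    (μα : Measure (EuclideanSpace ℝ (Fin d))) [IsProbabilityMeasure μα]
    (hchar : ∀ ξ, charFn μα ξ = Complex.exp (-((‖ξ‖ ^ α / 2 : ℝ) : ℂ)))
    (μ : Measure (EuclideanSpace ℝ (Fin d))) [IsProbabilityMeasure μ]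
    (hint : Integrable (fun x : EuclideanSpace ℝ (Fin d) => x) μ)
    (hcentered : (∫ x, x ∂μ) = 0)
    (hweyl : ∀ j : Fin d,
      Tendsto (fun R : ℝ =>
          variance (gTrunc R j) μ
            - ∫ x, ∫ u, (gTrunc R j (x + u) - gTrunc R j x) ^ 2 ∂(stableLevy d α) ∂μ)
        atTop (𝓝 0))
    (hU : Ufun (stableLevy d α) μ = 1) :
    μ = μα := by
  refine Measure.ext_of_charFun (funext fun ξ => ?_)
  rw [charFun_eq_charFn, charFun_eq_charFn, hchar,
    charFn_eq_exp hd hα hint hcentered hU hweyl]
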